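/- arXiv:1711.05060 — 3 statements merged into one kernel-verified Lean document; each statement's English description precedes it below -/
import Mathlib

section
/- Let K, M be positive integers with M ≤ K. Let y ∈ {−1,+1}^K be a label vector, o ∈ ℝ^K a fixed reference point, P ∈ ℝ^{M×K} a left-orthogonal matrix (i.e., P Pᵀ = I_M), and r ∈ ℝ^M a prediction vector. Define y' = y − o, z = P y', and the prediction ŷ ∈ ℝ^K by ŷ[k] = sign((Pᵀ r + o)[k]) for each k. Then the Hamming loss satisfies (1/K)·#{k : ŷ[k] ≠ y[k]} ≤ (1/K)·(‖r − z‖₂² + ‖(I_K − Pᵀ P) y'‖₂²). -/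
open Matrix BigOperators Finset

/-- Pythagoras for the splitting of `ℝ^K` induced by a matrix with orthonormal rows. -/
theorem sum_sq_transpose_mulVec_sub {m n : Type*} [Fintype m] [Fintype n] [DecidableEq m]
    [DecidableEq n] (P : Matrix m n ℝ) (hP : P * Pᵀ = 1) (r : m → ℝ) (v : n → ℝ) :
    ∑ k, ((Pᵀ *ᵥ r - v) k) ^ 2 =
      ∑ i, (r i - (P *ᵥ v) i) ^ 2 + ∑ k, (((1 - Pᵀ * P) *ᵥ v) k) ^ 2 := by
  set a : m → ℝ := r - P *ᵥ v with ha
  set b : n → ℝ := (1 - Pᵀ * P) *ᵥ v with hb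
  have hw : Pᵀ *ᵥ r - v = Pᵀ *ᵥ a - b := by
    rw [ha, hb, mulVec_sub, sub_mulVec, one_mulVec, mulVec_mulVec]
    abel
  have hPb : P *ᵥ b = 0 := by
    rw [hb, mulVec_mulVec, Matrix.mul_sub, ← Matrix.mul_assoc, hP]
    simp
  have haa : (Pᵀ *ᵥ a) ⬝ᵥ (Pᵀ *ᵥ a) = a ⬝ᵥ a := by
    rw [dotProduct_mulVec, vecMul_transpose, mulVec_mulVec, hP, one_mulVec]
  have hba : b ⬝ᵥ (Pᵀ *ᵥ a) = 0 := by
    rw [dotProduct_mulVec, vecMul_transpose, hPb, zero_dotProduct]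
  have key : (Pᵀ *ᵥ a - b) ⬝ᵥ (Pᵀ *ᵥ a - b) = a ⬝ᵥ a + b ⬝ᵥ b := by
    rw [sub_dotProduct, dotProduct_sub, dotProduct_sub, haa, hba, dotProduct_comm _ b, hba]
    ring
  rw [hw]
  simpa only [dotProduct, ← sq, ha, Pi.sub_apply] using key

/-- A wrong sign costs at least one in squared distance to the label. -/
theorem one_le_sq_sub_of_sign_ne {x y : ℝ} (hy : y = 1 ∨ y = -1) (h : Real.sign x ≠ y) :
    1 ≤ (x - y) ^ 2 := by
  rcases hy with rfl | rfl
  · have hx : x ≤ 0 := not_lt.mp fun hx => h (Real.sign_of_pos hx)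
    nlinarith
  · have hx : 0 ≤ x := not_lt.mp fun hx => h (Real.sign_of_neg hx)
    nlinarith

/-- Theorem 1 of the paper: for a left-orthogonal encoding matrix
`P`, reference point `o`, regression output `r` and `{-1,+1}`-valued label
vector `y`, the Hamming loss of the rounded prediction is bounded by the sum of
the prediction error and the reconstruction error (both scaled by `1/K`). -/
theorem stmt_0 (K M : ℕ) (hK : 0 < K) (hM : 0 < M) (hMK : M ≤ K)
    (y : Fin K → ℝ) (hy : ∀ k, y k = 1 ∨ y k = -1)
    (o : Fin K → ℝ)
    (P : Matrix (Fin M) (Fin K) ℝ) (hP : P * Pᵀ = 1)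
    (r : Fin M → ℝ)
    (y' : Fin K → ℝ) (hy' : y' = y - o)
    (z : Fin M → ℝ) (hz : z = P *ᵥ y')
    (yhat : Fin K → ℝ) (hyhat : ∀ k, yhat k = Real.sign ((Pᵀ *ᵥ r + o) k)) :
    (1 / K : ℝ) * (univ.filter fun k => yhat k ≠ y k).card ≤
      (1 / K : ℝ) *
        (∑ m, (r m - z m) ^ 2 + ∑ k, (((1 - Pᵀ * P) *ᵥ y') k) ^ 2) := by
  refine mul_le_mul_of_nonneg_left ?_ (by positivity)
  subst hz
  rw [← sum_sq_transpose_mulVec_sub P hP r y', Finset.card_filter, Nat.cast_sum]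
  refine Finset.sum_le_sum fun k _ => ?_
  split_ifs with h
  · rw [hyhat] at h
    have hk : (Pᵀ *ᵥ r - y') k = (Pᵀ *ᵥ r + o) k - y k := by
      simp only [hy', Pi.sub_apply, Pi.add_apply]
      ring
    rw [hk, Nat.cast_one]
    exact one_le_sq_sub_of_sign_ne (hy k) h
  · rw [Nat.cast_zero]
    positivity
end

section
/- Let K, M be positive integers with M + 1 ≤ K. Let Q ∈ ℝ^{(M+1)×K} be a left-orthogonal matrix (Q Qᵀ = I_{M+1}) and σ ∈ ℝ^{M+1} with 0 ≤ σ[i] ≤ 1 for each i and Σ_{i=1}^{M+1} σ[i] = M. Let U = Qᵀ diag(σ) Q, and for each i ∈ {1,…,M+1} let Q^{−i} ∈ ℝ^{M×K} denote Q with its i-th row removed. Then for every y ∈ ℝ^K, Σ_{i=1}^{M+1} (1 − σ[i]) · yᵀ (I_K − (Q^{−i})ᵀ Q^{−i}) y = yᵀ (I_K − U) y; that is, when P is sampled from the discrete distribution Γ assigning probability 1 − σ[i] to Q^{−i}, the expectation E_{P∼Γ}[yᵀ(I_K − Pᵀ P) y] equals yᵀ(I_K − U) y. -/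
open Matrix BigOperators Finset

/-- The matrix obtained from `Q` by deleting its `i`-th row. -/
def delRow {M K : ℕ} (Q : Matrix (Fin (M + 1)) (Fin K) ℝ) (i : Fin (M + 1)) :
    Matrix (Fin M) (Fin K) ℝ :=
  Q.submatrix i.succAbove id

/-- The quadratic form of `1 - Pᵀ P` is the squared norm minus that of `P y`. -/
lemma dotProduct_one_sub_transpose_mul_self_mulVec {m n : Type*} [Fintype m] [Fintype n]
    [DecidableEq n] (P : Matrix m n ℝ) (y : n → ℝ) :
    y ⬝ᵥ ((1 - Pᵀ * P) *ᵥ y) = y ⬝ᵥ y - ∑ j, (P *ᵥ y) j ^ 2 := by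
  rw [sub_mulVec, one_mulVec, dotProduct_sub, ← mulVec_mulVec, dotProduct_mulVec,
    vecMul_transpose]
  simp only [dotProduct, sq]

/-- The quadratic form of `Qᵀ diag(σ) Q` is the `σ`-weighted sum of squares of `Q y`. -/
lemma dotProduct_transpose_mul_diagonal_mul_mulVec {m n : Type*} [Fintype m] [Fintype n]
    [DecidableEq m] (Q : Matrix m n ℝ) (σ : m → ℝ) (y : n → ℝ) :
    y ⬝ᵥ ((Qᵀ * diagonal σ * Q) *ᵥ y) = ∑ i, σ i * (Q *ᵥ y) i ^ 2 := by
  rw [← mulVec_mulVec, ← mulVec_mulVec, dotProduct_mulVec, vecMul_transpose]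
  simp only [dotProduct, mulVec_diagonal]
  exact Finset.sum_congr rfl fun i _ => by ring

/-- Deleting the `i`-th row of `Q` removes the `i`-th term from the sum of squares of `Q y`. -/
lemma sum_delRow_mulVec_sq {M K : ℕ} (Q : Matrix (Fin (M + 1)) (Fin K) ℝ) (i : Fin (M + 1))
    (y : Fin K → ℝ) :
    ∑ j, (delRow Q i *ᵥ y) j ^ 2 = ∑ j, (Q *ᵥ y) j ^ 2 - (Q *ᵥ y) i ^ 2 := by
  rw [Fin.sum_univ_succAbove _ i, add_sub_cancel_left]
  rfl

/-- Lemma 1 of the paper: sampling `P = Q^{-i}` with probability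
`1 - σ i` gives an unbiased estimate of the reconstruction error:
`E_{P ~ Γ}[yᵀ (I - Pᵀ P) y] = yᵀ (I - U) y` with `U = Qᵀ diag(σ) Q`. -/
theorem stmt_3 (K M : ℕ) (hK : 0 < K) (hM : 0 < M) (hMK : M + 1 ≤ K)
    (Q : Matrix (Fin (M + 1)) (Fin K) ℝ) (hQ : Q * Qᵀ = 1)
    (σ : Fin (M + 1) → ℝ)
    (hσ0 : ∀ i, 0 ≤ σ i) (hσ1 : ∀ i, σ i ≤ 1) (hσsum : ∑ i, σ i = M)
    (U : Matrix (Fin K) (Fin K) ℝ) (hU : U = Qᵀ * diagonal σ * Q) :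
    ∀ y : Fin K → ℝ,
      ∑ i, (1 - σ i) * (y ⬝ᵥ ((1 - (delRow Q i)ᵀ * delRow Q i) *ᵥ y)) =
        y ⬝ᵥ ((1 - U) *ᵥ y) := by
  intro y
  have hw : ∑ i, (1 - σ i) = 1 := by simp [Finset.sum_sub_distrib, hσsum]
  have hsplit (i : Fin (M + 1)) :
      (1 - σ i) * (y ⬝ᵥ ((1 - (delRow Q i)ᵀ * delRow Q i) *ᵥ y)) =
        (1 - σ i) * (y ⬝ᵥ y - ∑ j, (Q *ᵥ y) j ^ 2) +
          ((Q *ᵥ y) i ^ 2 - σ i * (Q *ᵥ y) i ^ 2) := by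
    rw [dotProduct_one_sub_transpose_mul_self_mulVec, sum_delRow_mulVec_sq]
    ring
  simp only [hsplit]
  rw [Finset.sum_add_distrib, ← Finset.sum_mul, hw, Finset.sum_sub_distrib, hU, sub_mulVec,
    one_mulVec, dotProduct_sub, dotProduct_transpose_mul_diagonal_mul_mulVec]
  ring
end

section
/- Let d, T be positive integers and x_1,…,x_T ∈ ℝ^d with ‖x_t‖₂ ≤ 1 for all t. Define A_t = I_d + Σ_{i=1}^{t} x_i x_iᵀ for t = 1,…,T (so each A_t is positive definite). Then Σ_{t=1}^T x_tᵀ A_t^{−1} x_t ≤ d · log(1 + T/d). -/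
open Matrix BigOperators Finset

/-- Consequence of the matrix determinant lemma for a symmetric rank-one update. -/
lemma dotProduct_inv_mulVec_le_log_det_sub {n : Type*} [Fintype n] [DecidableEq n]
    {A B : Matrix n n ℝ} (hA : A.PosDef) (hB : B.PosDef) (v : n → ℝ)
    (h : A = B + vecMulVec v v) :
    v ⬝ᵥ (A⁻¹ *ᵥ v) ≤ Real.log A.det - Real.log B.det := by
  have hB' : B = A + replicateCol Unit (-v) * replicateRow Unit v := by
    rw [h, ← vecMulVec_eq, neg_vecMulVec, add_neg_cancel_right]
  have hdet : B.det = A.det * (1 - v ⬝ᵥ (A⁻¹ *ᵥ v)) := by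
    rw [hB', det_add_replicateCol_mul_replicateRow hA.det_pos.ne'.isUnit]
    congr 1
    rw [Matrix.mul_assoc, ← replicateCol_mulVec, det_unique]
    simp [mul_apply, dotProduct, mulVec_neg, sub_eq_add_neg]
  have hpos : 0 < 1 - v ⬝ᵥ (A⁻¹ *ᵥ v) :=
    pos_of_mul_pos_right (hdet ▸ hB.det_pos) hA.det_pos.le
  rw [hdet, Real.log_mul hA.det_pos.ne' hpos.ne']
  linarith [Real.log_le_sub_one_of_pos hpos]

/-- Logarithmic form of the AM-GM inequality for the eigenvalues of a positive definite matrix. -/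
lemma log_det_le_of_trace_le {n : Type*} [Fintype n] [DecidableEq n]
    {A : Matrix n n ℝ} (hA : A.PosDef) {c : ℝ} (hc : 0 < c)
    (h : A.trace ≤ Fintype.card n * c) :
    Real.log A.det ≤ Fintype.card n * Real.log c := by
  have hH := hA.isHermitian
  have hdet : A.det = ∏ i, hH.eigenvalues i := hH.det_eq_prod_eigenvalues
  have htr : A.trace = ∑ i, hH.eigenvalues i := hH.trace_eq_sum_eigenvalues
  have hlog : ∀ i, Real.log (hH.eigenvalues i) ≤ hH.eigenvalues i / c - 1 + Real.log c := by
    intro i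
    have hi := hA.eigenvalues_pos i
    have := Real.log_le_sub_one_of_pos (div_pos hi hc)
    rw [Real.log_div hi.ne' hc.ne'] at this
    linarith
  rw [hdet, Real.log_prod fun i _ => (hA.eigenvalues_pos i).ne']
  calc ∑ i, Real.log (hH.eigenvalues i)
      ≤ ∑ i, (hH.eigenvalues i / c - 1 + Real.log c) := Finset.sum_le_sum fun i _ => hlog i
    _ = A.trace / c - Fintype.card n + Fintype.card n * Real.log c := by
        rw [htr, Finset.sum_div]
        simp [Finset.sum_add_distrib, Finset.sum_sub_distrib]
    _ ≤ Fintype.card n * Real.log c := by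
        linarith [(div_le_iff₀ hc).2 h]

/-- The identity plus a sum of squares of vectors is positive definite. -/
lemma posDef_one_add_sum_vecMulVec {n ι : Type*} [Fintype n] [DecidableEq n]
    (s : Finset ι) (x : ι → n → ℝ) :
    (1 + ∑ i ∈ s, vecMulVec (x i) (x i)).PosDef :=
  PosDef.one.add_posSemidef <| posSemidef_sum s fun i _ => by
    simpa using posSemidef_vecMulVec_self_star (x i)

/-- elliptical potential bound: for vectors `x_1, …, x_T` with
`‖x_t‖ ≤ 1` and `A_t = I + Σ_{i ≤ t} x_i x_iᵀ`, we have
`Σ_t x_tᵀ A_t⁻¹ x_t ≤ d log(1 + T/d)`. -/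
theorem stmt_11 (d T : ℕ) (hd : 0 < d) (hT : 0 < T)
    (x : Fin T → Fin d → ℝ) (hx : ∀ t, ∑ j, (x t j) ^ 2 ≤ 1)
    (A : Fin T → Matrix (Fin d) (Fin d) ℝ)
    (hA : ∀ t, A t = 1 + ∑ i ∈ univ.filter (fun i => i ≤ t), vecMulVec (x i) (x i)) :
    ∑ t, x t ⬝ᵥ ((A t)⁻¹ *ᵥ x t) ≤ d * Real.log (1 + T / d) := by
  let G : ℕ → Matrix (Fin d) (Fin d) ℝ := fun n =>
    1 + ∑ i ∈ univ.filter (fun i : Fin T => (i : ℕ) < n), vecMulVec (x i) (x i)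
  have hG : ∀ n, (G n).PosDef := fun n => posDef_one_add_sum_vecMulVec _ x
  have hAG : ∀ t : Fin T, A t = G (t + 1) := fun t => by
    simp only [hA, G, Nat.lt_succ_iff, Fin.le_def]
  have hstep : ∀ t : Fin T, G (t + 1) = G t + vecMulVec (x t) (x t) := fun t => by
    have : univ.filter (fun i : Fin T => (i : ℕ) < t + 1)
        = insert t (univ.filter fun i : Fin T => (i : ℕ) < t) := by
      ext i
      simp only [mem_filter, mem_univ, true_and, mem_insert, Fin.ext_iff]
      omega
    simp only [G]
    rw [this, Finset.sum_insert (by simp)]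
    abel
  have hd' : (0 : ℝ) < d := Nat.cast_pos.2 hd
  have htr : (G T).trace ≤ Fintype.card (Fin d) * (1 + T / d : ℝ) := by
    have hsum : ∑ t, x t ⬝ᵥ x t ≤ T := by
      calc ∑ t, x t ⬝ᵥ x t ≤ ∑ _t : Fin T, (1 : ℝ) :=
            Finset.sum_le_sum fun t _ => by simpa [dotProduct, sq] using hx t
        _ = T := by simp
    have hfield : (d : ℝ) * (1 + T / d) = d + T := by field_simp
    simp only [G, Fin.is_lt, filter_true, trace_add, trace_one, trace_sum, trace_vecMulVec,
      Fintype.card_fin, hfield]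
    linarith
  calc ∑ t, x t ⬝ᵥ ((A t)⁻¹ *ᵥ x t)
      ≤ ∑ t : Fin T, (Real.log (G (t + 1)).det - Real.log (G t).det) :=
        Finset.sum_le_sum fun t _ => by
          rw [hAG]
          exact dotProduct_inv_mulVec_le_log_det_sub (hG _) (hG _) _ (hstep t)
    _ = Real.log (G T).det := by
        rw [Fin.sum_univ_eq_sum_range (fun n => Real.log (G (n + 1)).det - Real.log (G n).det),
          Finset.sum_range_sub fun n => Real.log (G n).det]
        simp [G]
    _ ≤ d * Real.log (1 + T / d) := by
        simpa using log_det_le_of_trace_le (hG T) (by positivity) htr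
end
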